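/- There exists a sequence (f_n)_{n≥1} of homeomorphisms of the unit square Q = [0,1]² onto itself such that: (1) for each n, the topological entropy of f_n is infinite; (2) for each n and each α ∈ (0,1), both f_n and f_n⁻¹ are α-Hölder continuous; (3) f_n converges to the identity in the C^α norm for every α ∈ [0,1), i.e. sup_Q |f_n − id| + [f_n − id]_α → 0 as n → ∞ (for α = 0 this is uniform convergence); and (4) each f_n is differentiable Lebesgue-almost everywhere on Q and, for every q ∈ [1,∞), ∫_Q |Df_n − Id|^q dμ → 0 as n → ∞. -/

import Mathlib

open Set Filter MeasureTheory
open scoped ENNReal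

/-- The unit square `Q = [0,1]²`. -/
def unitSq : Set (EuclideanSpace ℝ (Fin 2)) := {x | ∀ i, x i ∈ Set.Icc (0 : ℝ) 1}

/-- The entry-sum norm of the matrix `Df(x) - Id` of a map `f : ℝ² → ℝ²` at `x`. -/
noncomputable def derivDistId (f : EuclideanSpace ℝ (Fin 2) → EuclideanSpace ℝ (Fin 2))
    (x : EuclideanSpace ℝ (Fin 2)) : ℝ :=
  ∑ i : Fin 2, ∑ j : Fin 2,
    |fderiv ℝ f x (EuclideanSpace.single j 1) i - (if i = j then 1 else 0)|

/-- A bijection which is Lipschitz together with its inverse and is the identity outside a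
bounded set. -/
def IsCompactBiLipschitz {X : Type*} [NormedAddCommGroup X] (g : X ≃ X) : Prop :=
  (∃ K, LipschitzWith K g) ∧ (∃ K, LipschitzWith K g.symm) ∧ ∃ R : ℝ, ∀ x, R < ‖x‖ → g x = x

/-- For every `n`, the map `g` has `m ^ n` orbit segments of length `n` starting in `s` that are
pairwise `ε`-separated, for an `ε > 0` independent of `n`. -/
def HasSeparatedWords {X : Type*} [PseudoMetricSpace X] (g : X → X) (s : Set X) (m : ℕ) : Prop :=
  ∃ ε : ℝ, 0 < ε ∧ ∀ n : ℕ, ∃ p : (Fin n → Fin m) → X, (∀ w, p w ∈ s) ∧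
    ∀ w w', w ≠ w' → ∃ i < n, ε ≤ dist (g^[i] (p w)) (g^[i] (p w'))

theorem IsCompactBiLipschitz.trans {X : Type*} [NormedAddCommGroup X] {g h : X ≃ X}
    (hg : IsCompactBiLipschitz g) (hh : IsCompactBiLipschitz h) :
    IsCompactBiLipschitz (g.trans h) := by
  obtain ⟨⟨K, hK⟩, ⟨K', hK'⟩, R, hR⟩ := hg
  obtain ⟨⟨L, hL⟩, ⟨L', hL'⟩, R', hR'⟩ := hh
  refine ⟨⟨_, hL.comp hK⟩, ⟨_, hK'.comp hL'⟩, max R R', fun x hx => ?_⟩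
  rw [Equiv.trans_apply, hR x ((le_max_left _ _).trans_lt hx),
    hR' x ((le_max_right _ _).trans_lt hx)]

theorem IsCompactBiLipschitz.conj {X Y : Type*} [NormedAddCommGroup X] [NormedAddCommGroup Y]
    [NormedSpace ℝ X] [NormedSpace ℝ Y] {g : X ≃ X} (hg : IsCompactBiLipschitz g)
    (e : X ≃L[ℝ] Y) :
    IsCompactBiLipschitz ((e.symm.toEquiv.trans g).trans e.toEquiv) := by
  obtain ⟨⟨K, hK⟩, ⟨K', hK'⟩, R, hR⟩ := hg
  refine ⟨⟨_, e.lipschitz.comp (hK.comp e.symm.lipschitz)⟩,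
    ⟨_, e.lipschitz.comp (hK'.comp e.symm.lipschitz)⟩,
    ‖(e : X →L[ℝ] Y)‖ * R, fun y hy => ?_⟩
  have h1 : R < ‖e.symm y‖ := by
    by_contra! h
    have := (e : X →L[ℝ] Y).le_opNorm (e.symm y)
    simp only [ContinuousLinearEquiv.coe_coe, ContinuousLinearEquiv.apply_symm_apply] at this
    have := mul_le_mul_of_nonneg_left h (norm_nonneg (e : X →L[ℝ] Y))
    linarith
  have := hR _ h1
  simp only [Equiv.trans_apply]
  change e (g (e.symm y)) = y
  rw [this, e.apply_symm_apply]

theorem HasSeparatedWords.conj {X Y : Type*} [NormedAddCommGroup X] [NormedAddCommGroup Y]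
    [NormedSpace ℝ X] [NormedSpace ℝ Y] {g : X ≃ X} {s : Set X} {m : ℕ}
    (hg : HasSeparatedWords g s m) (e : X ≃L[ℝ] Y) :
    HasSeparatedWords ((e.symm.toEquiv.trans g).trans e.toEquiv) (e '' s) m := by
  obtain ⟨ε, hε, H⟩ := hg
  set K := ‖(e.symm : Y →L[ℝ] X)‖ + 1 with hK
  have hK0 : 0 < K := by positivity
  refine ⟨ε / K, by positivity, fun n => ?_⟩
  obtain ⟨p, hps, hp⟩ := H n
  refine ⟨fun w => e (p w), fun w => mem_image_of_mem e (hps w), fun w w' hw => ?_⟩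
  obtain ⟨i, hi, h⟩ := hp w w' hw
  refine ⟨i, hi, ?_⟩
  have hs : Function.Semiconj e g ((e.symm.toEquiv.trans g).trans e.toEquiv) := fun x => by
    change e (g x) = e (g (e.symm (e x)))
    rw [e.symm_apply_apply]
  rw [← (hs.iterate_right i) (p w), ← (hs.iterate_right i) (p w'), div_le_iff₀ hK0]
  refine h.trans ?_
  have := (e.symm : Y →L[ℝ] X).le_opNorm (e (g^[i] (p w)) - e (g^[i] (p w')))
  rw [← map_sub] at this
  simp only [ContinuousLinearEquiv.coe_coe, ContinuousLinearEquiv.symm_apply_apply] at this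
  rw [dist_eq_norm, dist_eq_norm, ← map_sub]
  nlinarith [norm_nonneg (e (g^[i] (p w) - g^[i] (p w')))]

/-- The number `t` truncated to the interval `[-ψ, ψ]`, where `ψ = max 0 ((R - |x| - |y|) / 2)`. -/
noncomputable def coneClamp (R x y t : ℝ) : ℝ :=
  max (-(max 0 ((R - |x| - |y|) / 2))) (min (max 0 ((R - |x| - |y|) / 2)) t)

theorem abs_coneClamp_sub_le (R x y t x' y' t' : ℝ) :
    |coneClamp R x y t - coneClamp R x' y' t'| ≤ max ((|x - x'| + |y - y'|) / 2) |t - t'| := by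
  have hψ : |max 0 ((R - |x| - |y|) / 2) - max 0 ((R - |x'| - |y'|) / 2)|
      ≤ (|x - x'| + |y - y'|) / 2 := by
    refine (abs_max_sub_max_le_max _ _ _ _).trans (max_le (by simp; positivity) ?_)
    have h1 := abs_abs_sub_abs_le x x'
    have h2 := abs_abs_sub_abs_le y y'
    rw [abs_le] at h1 h2 ⊢
    constructor <;> linarith [h1.1, h1.2, h2.1, h2.2]
  refine (abs_max_sub_max_le_max _ _ _ _).trans (max_le ?_ ?_)
  · rw [neg_sub_neg, abs_sub_comm]
    exact hψ.trans (le_max_left _ _)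
  · exact (abs_min_sub_min_le_max _ _ _ _).trans (max_le_max_right _ hψ)

theorem coneClamp_eq_self {R x y t : ℝ} (h : |t| ≤ (R - |x| - |y|) / 2) :
    coneClamp R x y t = t := by
  have h2 := h.trans (le_max_right 0 _)
  rw [abs_le] at h2
  rw [coneClamp, min_eq_right h2.2, max_eq_right h2.1]

theorem coneClamp_eq_zero {R x y t : ℝ} (h : R ≤ |x| + |y|) : coneClamp R x y t = 0 := by
  rw [coneClamp, max_eq_left (by linarith : (R - |x| - |y|) / 2 ≤ 0), neg_zero]
  exact max_eq_left (min_le_left _ _)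

/-- The vertical shear `(x, y) ↦ (x, y + b x)`, damped away from the origin. -/
noncomputable def dampedShear (R : ℝ) (b : ℝ → ℝ) (p : ℝ × ℝ) : ℝ × ℝ :=
  (p.1, p.2 + coneClamp R p.1 p.2 (b p.1))

section DampedShear

variable {R : ℝ} {b : ℝ → ℝ} {K : NNReal}

theorem abs_coneClamp_comp_sub_le (hb : LipschitzWith K b) (p q : ℝ × ℝ) :
    |coneClamp R p.1 p.2 (b p.1) - coneClamp R q.1 q.2 (b q.1)| ≤
      (K + 1) * |p.1 - q.1| + |p.2 - q.2| / 2 := by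
  refine (abs_coneClamp_sub_le _ _ _ _ _ _ _).trans ?_
  have h := hb.dist_le_mul p.1 q.1
  rw [Real.dist_eq, Real.dist_eq] at h
  have hK : 0 ≤ (K : ℝ) * |p.1 - q.1| := by positivity
  apply max_le <;> linarith [abs_nonneg (p.1 - q.1), abs_nonneg (p.2 - q.2)]

theorem lipschitzWith_dampedShear (hb : LipschitzWith K b) :
    LipschitzWith (K + 3) (dampedShear R b) := by
  refine LipschitzWith.of_dist_le_mul fun p q => ?_
  have h := abs_coneClamp_comp_sub_le (R := R) hb p q
  have h1 : |p.1 - q.1| ≤ dist p q := by rw [← Real.dist_eq]; exact le_max_left _ _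
  have h2 : |p.2 - q.2| ≤ dist p q := by rw [← Real.dist_eq]; exact le_max_right _ _
  have hK : (0 : ℝ) ≤ K := K.coe_nonneg
  have h3 := mul_le_mul_of_nonneg_left h1 (by positivity : (0 : ℝ) ≤ K + 1)
  rw [Prod.dist_eq (x := dampedShear R b p), Real.dist_eq, Real.dist_eq]
  simp only [dampedShear, NNReal.coe_add, NNReal.coe_ofNat]
  have h0 : 0 ≤ dist p q := dist_nonneg
  have hK0 : 0 ≤ K * dist p q := by positivity
  refine max_le (by nlinarith) ?_
  rw [add_sub_add_comm]
  refine (abs_add_le _ _).trans ?_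
  nlinarith

theorem antilipschitzWith_dampedShear (hb : LipschitzWith K b) :
    AntilipschitzWith (2 * K + 5) (dampedShear R b) := by
  refine AntilipschitzWith.of_le_mul_dist fun p q => ?_
  have h := abs_coneClamp_comp_sub_le (R := R) hb p q
  have h1 : |p.1 - q.1| ≤ dist (dampedShear R b p) (dampedShear R b q) := by
    rw [← Real.dist_eq]; exact le_max_left _ _
  have h2 : |(p.2 - q.2) + (coneClamp R p.1 p.2 (b p.1) - coneClamp R q.1 q.2 (b q.1))| ≤
      dist (dampedShear R b p) (dampedShear R b q) := by
    rw [← add_sub_add_comm, ← Real.dist_eq]; exact le_max_right _ _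
  have hK : (0 : ℝ) ≤ K := K.coe_nonneg
  have h3 := mul_le_mul_of_nonneg_left h1 (by positivity : (0 : ℝ) ≤ K + 1)
  have h4 := abs_sub_abs_le_abs_sub (p.2 - q.2)
    (-(coneClamp R p.1 p.2 (b p.1) - coneClamp R q.1 q.2 (b q.1)))
  rw [abs_neg, sub_neg_eq_add] at h4
  rw [Prod.dist_eq (x := p), Real.dist_eq, Real.dist_eq]
  push_cast
  have h0 : 0 ≤ dist (dampedShear R b p) (dampedShear R b q) := dist_nonneg
  have hK0 : 0 ≤ K * dist (dampedShear R b p) (dampedShear R b q) := by positivity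
  refine max_le (by nlinarith) (by nlinarith)

theorem surjective_dampedShear : Function.Surjective (dampedShear R b) := by
  rintro ⟨x, v⟩
  have hc : Continuous fun y => y + coneClamp R x y (b x) := by
    unfold coneClamp; fun_prop
  have hle : ∀ y, |coneClamp R x y (b x)| ≤ |b x| := fun y => by
    have h1 : (0 : ℝ) ≤ max 0 ((R - |x| - |y|) / 2) := le_max_left _ _
    have h2 := neg_abs_le (b x)
    have h3 := le_abs_self (b x)
    have h4 := abs_nonneg (b x)
    rw [coneClamp, abs_le]
    constructor
    · exact le_max_of_le_right (le_min (by linarith) h2)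
    · exact max_le (by linarith) ((min_le_right _ _).trans h3)
  have hs : Function.Surjective fun y => y + coneClamp R x y (b x) := by
    refine hc.surjective ?_ ?_
    · exact tendsto_atTop_add_right_of_le _ (-|b x|) tendsto_id
        fun y => (abs_le.1 (hle y)).1
    · exact tendsto_atBot_add_right_of_ge _ (|b x|) tendsto_id
        fun y => (abs_le.1 (hle y)).2
  obtain ⟨y, hy⟩ := hs v
  exact ⟨(x, y), Prod.ext rfl hy⟩

/-- The damped vertical shear as a bijection of the plane. -/
noncomputable def dampedShearEquiv (R : ℝ) (hb : LipschitzWith K b) : ℝ × ℝ ≃ ℝ × ℝ :=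
  Equiv.ofBijective (dampedShear R b)
    ⟨(antilipschitzWith_dampedShear hb).injective, surjective_dampedShear⟩

theorem isCompactBiLipschitz_dampedShearEquiv (hb : LipschitzWith K b) :
    IsCompactBiLipschitz (dampedShearEquiv R hb) := by
  refine ⟨⟨_, lipschitzWith_dampedShear hb⟩,
    ⟨_, (antilipschitzWith_dampedShear (R := R) hb).to_rightInverse
      (dampedShearEquiv R hb).apply_symm_apply⟩, R, fun p hp => ?_⟩
  refine Prod.ext rfl ?_
  change p.2 + coneClamp R p.1 p.2 (b p.1) = p.2
  rw [coneClamp_eq_zero, add_zero]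
  have : ‖p‖ ≤ |p.1| + |p.2| :=
    max_le (by simp [Real.norm_eq_abs]) (by simp [Real.norm_eq_abs])
  linarith

end DampedShear

/-- The exchange of coordinates of the plane. -/
noncomputable def swapPlane : (ℝ × ℝ) ≃L[ℝ] (ℝ × ℝ) := ContinuousLinearEquiv.prodComm ℝ ℝ ℝ

/-- A sawtooth profile, affine of slope `L - 2` on each interval `[j, j + 1/2]` with `j : ℤ`. -/
noncomputable def sawtooth (L x : ℝ) : ℝ := L * ‖(x : UnitAddCircle)‖ - 2 * x

theorem lipschitzWith_sawtooth {L : ℝ} (hL : 0 ≤ L) :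
    LipschitzWith (L.toNNReal + 2) (sawtooth L) := by
  refine LipschitzWith.of_dist_le_mul fun x y => ?_
  have h1 : |‖(x : UnitAddCircle)‖ - ‖(y : UnitAddCircle)‖| ≤ |x - y| := by
    refine (abs_norm_sub_norm_le _ _).trans ?_
    rw [← AddCircle.coe_sub]
    rw [UnitAddCircle.norm_eq]
    simpa using round_le (x - y) 0
  rw [Real.dist_eq, Real.dist_eq]
  push_cast
  rw [Real.coe_toNNReal _ hL]
  have h2 := mul_le_mul_of_nonneg_left h1 hL
  have h3 : sawtooth L x - sawtooth L y =
      L * (‖(x : UnitAddCircle)‖ - ‖(y : UnitAddCircle)‖) + (-2) * (x - y) := by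
    unfold sawtooth; ring
  rw [h3]
  refine (abs_add_le _ _).trans ?_
  rw [abs_mul, abs_mul, abs_of_nonneg hL]
  norm_num
  linarith

theorem sawtooth_eq {L x : ℝ} (j : ℕ) (h : x ∈ Icc (j : ℝ) (j + 1 / 4)) :
    sawtooth L x = L * (x - j) - 2 * x := by
  have : round x = (j : ℤ) := by
    rw [round_eq_iff]
    push_cast
    exact ⟨by linarith [h.1], by linarith [h.2]⟩
  rw [sawtooth, UnitAddCircle.norm_eq, this]
  push_cast
  rw [abs_of_nonneg (by linarith [h.1])]

/-- A damped version of the standard-like map `(x, y) ↦ (x + y + b x, y + b x)`, with `b` the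
sawtooth profile of parameter `L`. -/
noncomputable def standardMap (R : ℝ) {L : ℝ} (hL : 0 ≤ L) : ℝ × ℝ ≃ ℝ × ℝ :=
  (dampedShearEquiv R (lipschitzWith_sawtooth hL)).trans
    ((swapPlane.symm.toEquiv.trans (dampedShearEquiv R LipschitzWith.id)).trans swapPlane.toEquiv)

theorem isCompactBiLipschitz_standardMap (R : ℝ) {L : ℝ} (hL : 0 ≤ L) :
    IsCompactBiLipschitz (standardMap R hL) :=
  (isCompactBiLipschitz_dampedShearEquiv _).trans
    ((isCompactBiLipschitz_dampedShearEquiv _).conj swapPlane)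

theorem standardMap_apply {R L : ℝ} (hL : 0 ≤ L) {x y : ℝ}
    (h1 : 2 * |sawtooth L x| + |x| + |y| ≤ R)
    (h2 : 3 * |y + sawtooth L x| + |x| ≤ R) :
    standardMap R hL (x, y) = (x + (y + sawtooth L x), y + sawtooth L x) := by
  have e1 : standardMap R hL (x, y) =
      (x + coneClamp R (y + coneClamp R x y (sawtooth L x)) x
        (y + coneClamp R x y (sawtooth L x)), y + coneClamp R x y (sawtooth L x)) := rfl
  rw [e1, coneClamp_eq_self (t := sawtooth L x) (by linarith), coneClamp_eq_self (by linarith)]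

theorem exists_standardMap_itinerary {m : ℕ} {R L : ℝ} (hL0 : 0 ≤ L) (hL : 8 * m + 1 ≤ L)
    (hR : 20 * m ≤ R) (n : ℕ) (w : ℕ → ℕ) (hw : ∀ i, w i < m) :
    ∃ s t : ℝ, s ∈ Icc (0 : ℝ) 1 ∧ ∀ u ∈ Icc (0 : ℝ) m, s * u + t ∈ Icc (0 : ℝ) m ∧
      ∀ i < n, ((standardMap R hL0)^[i] (s * u + t, s * u + t - u)).1 ∈
        Icc (w i : ℝ) (w i + 1 / 4) := by
  induction n generalizing w with
  | zero => exact ⟨0, 0, by simp, fun u hu => by simp⟩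
  | succ n ih =>
    obtain ⟨s, t, hs, H⟩ := ih (fun i => w (i + 1)) (fun i => hw _)
    have hj : (w 0 : ℝ) + 1 ≤ m := by exact_mod_cast hw 0
    have hj0 : (0 : ℝ) ≤ w 0 := by positivity
    set j : ℝ := (w 0 : ℝ) with hj_def
    have hm : (1 : ℝ) ≤ m := by linarith
    have hLs : 0 < L - s := by linarith [hs.2]
    refine ⟨1 / (L - s), (L * j + t) / (L - s), ⟨by positivity, ?_⟩, fun u hu => ?_⟩
    · rw [div_le_one hLs]; linarith [hs.2]
    set x := 1 / (L - s) * u + (L * j + t) / (L - s) with hx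
    have hxe : L * (x - j) - u = s * x + t := by rw [hx]; field_simp; ring
    have hxj : (L - s) * (x - j) = u + (s * j + t) := by linarith
    have hc := (H j ⟨hj0, by linarith⟩).1
    have hx1 : j ≤ x := by
      by_contra! h
      nlinarith [hu.1, hc.1]
    have hx2 : x ≤ j + 1 / 4 := by
      by_contra! h
      nlinarith [hu.2, hc.2, hs.2]
    have hxm : x ∈ Icc (0 : ℝ) m := ⟨by linarith, by linarith⟩
    refine ⟨hxm, ?_⟩
    obtain ⟨hx', Hx⟩ := H x hxm
    have hsaw : sawtooth L x = L * (x - j) - 2 * x := sawtooth_eq _ ⟨hx1, hx2⟩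
    have hy : (x - u) + sawtooth L x = s * x + t - x := by rw [hsaw]; linarith
    have hb : sawtooth L x = s * x + t + u - 2 * x := by linarith
    have hG : standardMap R hL0 (x, x - u) = (s * x + t, s * x + t - x) := by
      rw [standardMap_apply, hy]
      · simp
      · have e1 : |sawtooth L x| ≤ 4 * m := by
          rw [hb, abs_le]; constructor <;> linarith [hu.1, hu.2, hx'.1, hx'.2, hxm.1, hxm.2]
        have e2 : |x| ≤ m := by rw [abs_of_nonneg hxm.1]; exact hxm.2
        have e3 : |x - u| ≤ m := by
          rw [abs_le]; constructor <;> linarith [hu.1, hu.2, hxm.1, hxm.2]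
        linarith
      · rw [hy]
        have e2 : |x| ≤ m := by rw [abs_of_nonneg hxm.1]; exact hxm.2
        have e3 : |s * x + t - x| ≤ m := by
          rw [abs_le]; constructor <;> linarith [hx'.1, hx'.2, hxm.1, hxm.2]
        linarith
    rintro (_ | i) hi
    · exact ⟨hx1, hx2⟩
    · rw [Function.iterate_succ_apply, hG]
      exact Hx i (by omega)

theorem hasSeparatedWords_standardMap {m : ℕ} {R L : ℝ} (hL0 : 0 ≤ L) (hL : 8 * m + 1 ≤ L)
    (hR : 20 * m ≤ R) :
    HasSeparatedWords (standardMap R hL0) (Metric.closedBall 0 m) m := by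
  rcases Nat.eq_zero_or_pos m with rfl | hm
  · refine ⟨1, one_pos, fun n => ⟨fun _ => 0, fun w => by simp, fun w w' hww => ?_⟩⟩
    exact absurd (funext fun i => (w i).elim0) hww
  refine ⟨1 / 2, by norm_num, fun n => ?_⟩
  have key : ∀ w : Fin n → Fin m, ∃ p ∈ Metric.closedBall (0 : ℝ × ℝ) m, ∀ i : Fin n,
      ((standardMap R hL0)^[i] p).1 ∈ Icc ((w i : ℕ) : ℝ) ((w i : ℕ) + 1 / 4) := fun w => by
    obtain ⟨s, t, -, H⟩ := exists_standardMap_itinerary hL0 hL hR n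
      (fun i => if h : i < n then (w ⟨i, h⟩ : ℕ) else 0)
      (fun i => by split_ifs <;> simp [hm])
    obtain ⟨H1, H2⟩ := H 0 ⟨le_rfl, by positivity⟩
    refine ⟨(s * 0 + t, s * 0 + t - 0), ?_, fun i => by simpa using H2 i i.2⟩
    rw [mem_closedBall_zero_iff, Prod.norm_mk, sub_zero, max_self, Real.norm_eq_abs,
      abs_of_nonneg H1.1]
    exact H1.2
  choose p hpm hp using key
  refine ⟨p, hpm, fun w w' hww => ?_⟩
  obtain ⟨i, hi⟩ := Function.ne_iff.1 hww
  refine ⟨i, i.2, ?_⟩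
  refine le_trans ?_ (le_max_left _ _)
  have h1 := hp w i
  have h2 := hp w' i
  have hne : (w i : ℕ) ≠ (w' i : ℕ) := fun h => hi (Fin.ext h)
  rw [Real.dist_eq]
  rcases lt_or_gt_of_ne hne with h | h
  · have : ((w i : ℕ) : ℝ) + 1 ≤ (w' i : ℕ) := by exact_mod_cast h
    rw [abs_sub_comm]
    exact le_trans (by linarith [h1.2, h2.1]) (le_abs_self _)
  · have : ((w' i : ℕ) : ℝ) + 1 ≤ (w i : ℕ) := by exact_mod_cast h
    exact le_trans (by linarith [h1.1, h2.2]) (le_abs_self _)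

theorem exists_isCompactBiLipschitz_hasSeparatedWords (m : ℕ) :
    ∃ (g : EuclideanSpace ℝ (Fin 2) ≃ EuclideanSpace ℝ (Fin 2)) (B : ℝ),
      IsCompactBiLipschitz g ∧ HasSeparatedWords g (Metric.closedBall 0 B) m := by
  have hL0 : (0 : ℝ) ≤ 8 * m + 1 := by positivity
  let e := ((EuclideanSpace.equiv (Fin 2) ℝ).trans
    (ContinuousLinearEquiv.finTwoArrow (R := ℝ) (M := ℝ))).symm
  obtain ⟨ε, hε, H⟩ := (hasSeparatedWords_standardMap hL0 le_rfl le_rfl).conj e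
  refine ⟨_, ‖(e : (ℝ × ℝ) →L[ℝ] EuclideanSpace ℝ (Fin 2))‖ * m,
    (isCompactBiLipschitz_standardMap (20 * m) hL0).conj e, ε, hε, fun n => ?_⟩
  obtain ⟨p, hpm, hp⟩ := H n
  refine ⟨p, fun w => ?_, hp⟩
  obtain ⟨x, hx, hxp⟩ := hpm w
  rw [← hxp, mem_closedBall_zero_iff]
  rw [mem_closedBall_zero_iff] at hx
  exact ((e : (ℝ × ℝ) →L[ℝ] EuclideanSpace ℝ (Fin 2)).le_opNorm x).trans (by gcongr)

/-- The map `h` differs from the identity only inside the ball of centre `c` and radius `A * r`,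
where the displacement `h - id` is bounded by `A * r` and `A`-Lipschitz. -/
structure IsLocalPerturbation {X : Type*} [NormedAddCommGroup X] (h : X → X) (c : X)
    (A r : ℝ) : Prop where
  eq_self : ∀ z, z ∉ Metric.closedBall c (A * r) → h z = z
  norm_sub_le : ∀ z, ‖h z - z‖ ≤ A * r
  norm_sub_sub_le : ∀ z w, ‖(h z - z) - (h w - w)‖ ≤ A * ‖z - w‖

theorem IsCompactBiLipschitz.symm {X : Type*} [NormedAddCommGroup X] {g : X ≃ X}
    (hg : IsCompactBiLipschitz g) : IsCompactBiLipschitz g.symm := by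
  obtain ⟨h1, h2, R, hR⟩ := hg
  exact ⟨h2, h1, R, fun x hx => by rw [Equiv.symm_apply_eq, hR x hx]⟩

theorem IsCompactBiLipschitz.exists_isLocalPerturbation {X : Type*} [NormedAddCommGroup X]
    {g : X ≃ X} (hg : IsCompactBiLipschitz g) :
    ∃ A₀ : ℝ, ∀ A, A₀ ≤ A → IsLocalPerturbation g 0 A 1 := by
  obtain ⟨⟨K, hK⟩, -, R, hR⟩ := hg
  refine ⟨K + 1 + 2 * |R|, fun A hA => ?_⟩
  have hK0 : (0 : ℝ) ≤ K := K.coe_nonneg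
  have hR1 := le_abs_self R
  have hR0 := abs_nonneg R
  refine ⟨fun z hz => hR z ?_, fun z => ?_, fun z w => ?_⟩
  · rw [mem_closedBall_zero_iff, not_le] at hz
    linarith
  · by_cases hz : R < ‖z‖
    · rw [hR z hz, sub_self, norm_zero]; linarith
    · have hgz : ¬ R < ‖g z‖ := fun h => by
        have := g.injective (hR _ h)
        rw [this] at h
        exact hz h
      refine (_root_.norm_sub_le _ _).trans ?_
      linarith
  · have e : (g z - z) - (g w - w) = (g z - g w) - (z - w) := by abel
    rw [e]
    refine (_root_.norm_sub_le _ _).trans ?_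
    have h1 := hK.dist_le_mul z w
    rw [dist_eq_norm, dist_eq_norm] at h1
    have h2 := mul_le_mul_of_nonneg_right hA (norm_nonneg (z - w))
    have h3 := mul_nonneg hR0 (norm_nonneg (z - w))
    nlinarith

section Rescale

variable {X : Type*} [NormedAddCommGroup X] [NormedSpace ℝ X]

/-- The conjugate of `g` by the similarity `z ↦ c + r • z`. -/
noncomputable def rescale (c : X) {r : ℝ} (hr : 0 < r) (g : X ≃ X) : X ≃ X where
  toFun z := c + r • g (r⁻¹ • (z - c))
  invFun z := c + r • g.symm (r⁻¹ • (z - c))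
  left_inv z := by simp [hr.ne']
  right_inv z := by simp [hr.ne']

theorem IsLocalPerturbation.rescale {c : X} {r A : ℝ} (hr : 0 < r) {g : X ≃ X}
    (hg : IsLocalPerturbation g 0 A 1) : IsLocalPerturbation (rescale c hr g) c A r := by
  have key : ∀ z, _root_.rescale c hr g z - z =
      r • (g (r⁻¹ • (z - c)) - r⁻¹ • (z - c)) := fun z => by
    rw [smul_sub, smul_inv_smul₀ hr.ne']
    simp only [_root_.rescale, Equiv.coe_fn_mk]
    abel
  have hnr : ‖r‖ = r := by rw [Real.norm_eq_abs, abs_of_pos hr]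
  refine ⟨fun z hz => ?_, fun z => ?_, fun z w => ?_⟩
  · rw [← sub_eq_zero, key, hg.eq_self, sub_self, smul_zero]
    rw [mem_closedBall_zero_iff, norm_smul, norm_inv, hnr]
    rw [mem_closedBall_iff_norm] at hz
    intro h
    rw [inv_mul_le_iff₀ hr] at h
    exact hz (by linarith)
  · rw [key, norm_smul, hnr]
    nlinarith [hg.norm_sub_le (r⁻¹ • (z - c))]
  · rw [key, key, ← smul_sub, norm_smul, hnr]
    have h := hg.norm_sub_sub_le (r⁻¹ • (z - c)) (r⁻¹ • (w - c))
    rw [← smul_sub, sub_sub_sub_cancel_right, norm_smul, norm_inv, hnr] at h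
    calc _ ≤ r * (A * (r⁻¹ * ‖z - w‖)) := by gcongr
      _ = A * ‖z - w‖ := by field_simp

theorem HasSeparatedWords.rescale (c : X) {r : ℝ} (hr : 0 < r) {g : X ≃ X} {B : ℝ} {m : ℕ}
    (hg : HasSeparatedWords g (Metric.closedBall 0 B) m) :
    HasSeparatedWords (rescale c hr g) (Metric.closedBall c (B * r)) m := by
  obtain ⟨ε, hε, H⟩ := hg
  refine ⟨r * ε, by positivity, fun n => ?_⟩
  obtain ⟨p, hpB, hp⟩ := H n
  have hnr : ‖r‖ = r := by rw [Real.norm_eq_abs, abs_of_pos hr]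
  have hs : Function.Semiconj (fun z => c + r • z) g (_root_.rescale c hr g) := fun z => by
    simp [_root_.rescale, hr.ne']
  refine ⟨fun w => c + r • p w, fun w => ?_, fun w w' hw => ?_⟩
  · have := hpB w
    rw [mem_closedBall_zero_iff] at this
    rw [mem_closedBall_iff_norm, add_sub_cancel_left, norm_smul, hnr, mul_comm]
    gcongr
  · obtain ⟨i, hi, h⟩ := hp w w' hw
    refine ⟨i, hi, ?_⟩
    rw [← (hs.iterate_right i) (p w), ← (hs.iterate_right i) (p w'), dist_add_left,
      dist_smul₀, hnr]
    gcongr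

end Rescale

theorem HasSeparatedWords.mono {X : Type*} [PseudoMetricSpace X] {g : X → X} {s t : Set X}
    {m : ℕ} (hg : HasSeparatedWords g s m) (hst : s ⊆ t) : HasSeparatedWords g t m := by
  obtain ⟨ε, hε, H⟩ := hg
  refine ⟨ε, hε, fun n => ?_⟩
  obtain ⟨p, hps, hp⟩ := H n
  exact ⟨p, fun w => hst (hps w), hp⟩

/-- A sequence of perturbations of the identity of the plane with centres `c k`, with radii
`A k * r k` that are small compared to every power of the Lipschitz constants `A k`, and with
unbounded complexity. -/
structure PerturbationSequence (c : ℕ → EuclideanSpace ℝ (Fin 2)) where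
  h : ℕ → EuclideanSpace ℝ (Fin 2) ≃ EuclideanSpace ℝ (Fin 2)
  A : ℕ → ℝ
  r : ℕ → ℝ
  one_le_A : ∀ k, 1 ≤ A k
  r_pos : ∀ k, 0 < r k
  A_pow_mul_r_le : ∀ k, A k ^ (k + 1) * r k ≤ (1 / 2) ^ k / 8
  pert : ∀ k, IsLocalPerturbation (h k) (c k) (A k) (r k)
  pert_symm : ∀ k, IsLocalPerturbation (h k).symm (c k) (A k) (r k)
  sep : ∀ k, HasSeparatedWords (h k) (Metric.closedBall (c k) (A k * r k)) (k + 1)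

theorem nonempty_perturbationSequence (c : ℕ → EuclideanSpace ℝ (Fin 2)) :
    Nonempty (PerturbationSequence c) := by
  have key : ∀ k : ℕ, ∃ (h : EuclideanSpace ℝ (Fin 2) ≃ EuclideanSpace ℝ (Fin 2)) (A r : ℝ),
      1 ≤ A ∧ 0 < r ∧ A ^ (k + 1) * r ≤ (1 / 2) ^ k / 8 ∧ IsLocalPerturbation h (c k) A r ∧
      IsLocalPerturbation h.symm (c k) A r ∧
      HasSeparatedWords h (Metric.closedBall (c k) (A * r)) (k + 1) := fun k => by
    obtain ⟨g, B, hg, hsep⟩ := exists_isCompactBiLipschitz_hasSeparatedWords (k + 1)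
    obtain ⟨A₁, h₁⟩ := hg.exists_isLocalPerturbation
    obtain ⟨A₂, h₂⟩ := hg.symm.exists_isLocalPerturbation
    set A := max (max 1 B) (max A₁ A₂)
    have hA1 : 1 ≤ A := (le_max_left _ _).trans (le_max_left _ _)
    have hAB : B ≤ A := (le_max_right _ _).trans (le_max_left _ _)
    have hA0 : 0 < A := by linarith
    have hr : 0 < (1 / 2 : ℝ) ^ k / 8 / A ^ (k + 1) := by positivity
    refine ⟨rescale (c k) hr g, A, _, hA1, hr, ?_,
      (h₁ A ((le_max_left _ _).trans (le_max_right _ _))).rescale hr,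
      (h₂ A ((le_max_right _ _).trans (le_max_right _ _))).rescale hr,
      (hsep.rescale (c k) hr).mono (Metric.closedBall_subset_closedBall (by gcongr))⟩
    rw [mul_div_cancel₀ _ (by positivity)]
  choose h A r h1 h2 h3 h4 h5 h6 using key
  exact ⟨⟨h, A, r, h1, h2, h3, h4, h5, h6⟩⟩

open Classical in
/-- The map equal to `e k` on `D k` for `k ≥ n`, and to the identity elsewhere. -/
noncomputable def glue {X : Type*} (D : ℕ → Set X) (n : ℕ) (e : ℕ → X → X) (z : X) : X :=
  if h : ∃ k, n ≤ k ∧ z ∈ D k then e h.choose z else z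

section Glue

variable {X : Type*} {D : ℕ → Set X} {n : ℕ} {e : ℕ → X → X}

theorem glue_of_mem (hD : ∀ j k z, z ∈ D j → z ∈ D k → j = k) {k : ℕ} (hk : n ≤ k) {z : X}
    (hz : z ∈ D k) : glue D n e z = e k z := by
  have h : ∃ k, n ≤ k ∧ z ∈ D k := ⟨k, hk, hz⟩
  rw [glue, dif_pos h, hD _ _ z h.choose_spec.2 hz]

theorem glue_of_forall_notMem {z : X} (hz : ∀ k, n ≤ k → z ∉ D k) : glue D n e z = z := by
  rw [glue, dif_neg]
  rintro ⟨k, hk, h⟩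
  exact hz k hk h

theorem glue_leftInverse (hD : ∀ j k z, z ∈ D j → z ∈ D k → j = k) {e' : ℕ → X → X}
    (hm : ∀ k, MapsTo (e k) (D k) (D k)) (he : ∀ k, Function.LeftInverse (e' k) (e k)) :
    Function.LeftInverse (glue D n e') (glue D n e) := fun z => by
  by_cases h : ∃ k, n ≤ k ∧ z ∈ D k
  · obtain ⟨k, hk, hz⟩ := h
    rw [glue_of_mem hD hk hz, glue_of_mem hD hk (hm k hz), he k z]
  · push Not at h
    rw [glue_of_forall_notMem h, glue_of_forall_notMem h]

theorem glue_mapsTo (hD : ∀ j k z, z ∈ D j → z ∈ D k → j = k)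
    (hm : ∀ k, MapsTo (e k) (D k) (D k)) {s : Set X} (hs : ∀ k, D k ⊆ s) :
    MapsTo (glue D n e) s s := fun z hzs => by
  by_cases h : ∃ k, n ≤ k ∧ z ∈ D k
  · obtain ⟨k, hk, hz⟩ := h
    rw [glue_of_mem hD hk hz]
    exact hs k (hm k hz)
  · push Not at h
    rwa [glue_of_forall_notMem h]

theorem glue_iterate (hD : ∀ j k z, z ∈ D j → z ∈ D k → j = k)
    (hm : ∀ k, MapsTo (e k) (D k) (D k)) {k : ℕ} (hk : n ≤ k) {z : X} (hz : z ∈ D k) (i : ℕ) :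
    (glue D n e)^[i] z = (e k)^[i] z := by
  induction i generalizing z with
  | zero => rfl
  | succ i ih =>
    rw [Function.iterate_succ_apply, Function.iterate_succ_apply, glue_of_mem hD hk hz,
      ih (hm k hz)]

theorem exists_glue_eq (hD : ∀ j k z, z ∈ D j → z ∈ D k → j = k)
    (he : ∀ k z, z ∉ D k → e k z = z) (n : ℕ) (z : X) :
    ∃ k, n ≤ k ∧ glue D n e z = e k z ∧ ∀ j, n ≤ j → j ≠ k → e j z = z := by
  by_cases h : ∃ k, n ≤ k ∧ z ∈ D k
  · obtain ⟨k, hk, hz⟩ := h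
    exact ⟨k, hk, glue_of_mem hD hk hz, fun j _ hj => he j z fun hzj => hj (hD _ _ z hzj hz)⟩
  · push Not at h
    exact ⟨n, le_rfl, by rw [glue_of_forall_notMem h, he n z (h n le_rfl)],
      fun j hj _ => he j z (h j hj)⟩

theorem norm_glue_sub_sub_le {X : Type*} [NormedAddCommGroup X] {D : ℕ → Set X} {n : ℕ}
    {e : ℕ → X → X} (hD : ∀ j k z, z ∈ D j → z ∈ D k → j = k)
    (he : ∀ k z, z ∉ D k → e k z = z) {z w : X} {C : ℝ}
    (hC : ∀ k, n ≤ k → ‖(e k z - z) - (e k w - w)‖ ≤ C) :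
    ‖(glue D n e z - z) - (glue D n e w - w)‖ ≤ 2 * C := by
  obtain ⟨i, hi, hzi, hz⟩ := exists_glue_eq hD he n z
  obtain ⟨j, hj, hwj, hw⟩ := exists_glue_eq hD he n w
  rw [hzi, hwj]
  have h1 := hC i hi
  have h2 := hC j hj
  rcases eq_or_ne i j with rfl | hij
  · linarith [norm_nonneg (e i z - z - (e i w - w))]
  · rw [hw i hi hij, sub_self, sub_zero] at h1
    rw [hz j hj hij.symm, sub_self, zero_sub, norm_neg] at h2
    refine (norm_sub_le _ _).trans (by linarith)

end Glue

theorem IsLocalPerturbation.mapsTo {X : Type*} [NormedAddCommGroup X] {h : X ≃ X} {c : X}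
    {A r : ℝ} (H : IsLocalPerturbation h c A r) :
    MapsTo h (Metric.closedBall c (A * r)) (Metric.closedBall c (A * r)) := fun z hz => by
  by_contra hn
  have := h.injective (H.eq_self _ hn)
  rw [this] at hn
  exact hn hz

theorem IsLocalPerturbation.norm_sub_sub_le_rpow {X : Type*} [NormedAddCommGroup X] {h : X → X}
    {c : X} {A r : ℝ} (H : IsLocalPerturbation h c A r) (hA : 0 < A) (hr : 0 < r) {α : ℝ}
    (h0 : 0 ≤ α) (h1 : α < 1) (z w : X) :
    ‖(h z - z) - (h w - w)‖ ≤ 2 * A * r ^ (1 - α) * dist z w ^ α := by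
  set x := ‖(h z - z) - (h w - w)‖ with hx
  have hx0 : 0 ≤ x := norm_nonneg _
  have hx1 : x ≤ (2 * A) * dist z w := by
    rw [dist_eq_norm]
    have := H.norm_sub_sub_le z w
    have := mul_nonneg hA.le (norm_nonneg (z - w))
    linarith
  have hx2 : x ≤ (2 * A) * r := by
    have := _root_.norm_sub_le (h z - z) (h w - w)
    linarith [H.norm_sub_le z, H.norm_sub_le w]
  have h2A : 0 ≤ 2 * A := by linarith
  have hα : 0 ≤ 1 - α := by linarith
  calc x = x ^ α * x ^ (1 - α) := by
        rw [← Real.rpow_add' hx0 (by norm_num)]; norm_num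
    _ ≤ ((2 * A) * dist z w) ^ α * ((2 * A) * r) ^ (1 - α) := by gcongr
    _ = ((2 * A) ^ α * (2 * A) ^ (1 - α)) * r ^ (1 - α) * dist z w ^ α := by
        rw [Real.mul_rpow h2A dist_nonneg, Real.mul_rpow h2A hr.le]; ring
    _ = _ := by
        rw [← Real.rpow_add' h2A (by norm_num)]; norm_num

/-- The centres of the perturbations. -/
noncomputable def dyadicCenter (k : ℕ) : EuclideanSpace ℝ (Fin 2) :=
  !₂[3 / 4 * (1 / 2) ^ k, 1 / 2]

namespace PerturbationSequence

variable (P : PerturbationSequence dyadicCenter)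

/-- The ball supporting the `k`-th perturbation. -/
def D (k : ℕ) : Set (EuclideanSpace ℝ (Fin 2)) :=
  Metric.closedBall (dyadicCenter k) (P.A k * P.r k)

theorem A_mul_r_le (k : ℕ) : P.A k * P.r k ≤ (1 / 2) ^ k / 8 := by
  refine le_trans ?_ (P.A_pow_mul_r_le k)
  gcongr
  · exact (P.r_pos k).le
  · exact le_self_pow₀ (P.one_le_A k) (by omega)

theorem r_le_one (k : ℕ) : P.r k ≤ 1 := by
  have h1 := P.A_mul_r_le k
  have h2 := mul_le_mul_of_nonneg_right (P.one_le_A k) (P.r_pos k).le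
  have h3 : (1 / 2 : ℝ) ^ k ≤ 1 := pow_le_one₀ (by norm_num) (by norm_num)
  linarith

theorem fst_mem_of_mem_D {k : ℕ} {z : EuclideanSpace ℝ (Fin 2)} (hz : z ∈ P.D k) :
    z 0 ∈ Icc (5 / 8 * (1 / 2 : ℝ) ^ k) (7 / 8 * (1 / 2) ^ k) := by
  have h := PiLp.norm_apply_le (z - dyadicCenter k) 0
  have h2 := h.trans (mem_closedBall_iff_norm.1 hz)
  have h3 := h2.trans (P.A_mul_r_le k)
  simp only [dyadicCenter, PiLp.sub_apply, Real.norm_eq_abs] at h3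
  rw [abs_le] at h3
  norm_num at h3 ⊢
  constructor <;> linarith [h3.1, h3.2]

theorem D_subset_unitSq (k : ℕ) : P.D k ⊆ unitSq := by
  intro z hz i
  have h3 : (1 / 2 : ℝ) ^ k ≤ 1 := pow_le_one₀ (by norm_num) (by norm_num)
  have h4 : 0 < (1 / 2 : ℝ) ^ k := by positivity
  fin_cases i
  · have := P.fst_mem_of_mem_D hz
    exact ⟨by simp; linarith [this.1], by simp; linarith [this.2]⟩
  · have h := PiLp.norm_apply_le (z - dyadicCenter k) 1
    have h2 := (h.trans (mem_closedBall_iff_norm.1 hz)).trans (P.A_mul_r_le k)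
    simp only [dyadicCenter, PiLp.sub_apply, Real.norm_eq_abs] at h2
    rw [abs_le] at h2
    norm_num at h2 h3
    change z 1 ∈ Icc (0 : ℝ) 1
    constructor <;> linarith [h2.1, h2.2]

theorem eq_of_mem_D {j k : ℕ} {z : EuclideanSpace ℝ (Fin 2)} (hz : z ∈ P.D j)
    (h1 : (1 / 2 : ℝ) ^ (k + 1) < z 0) (h2 : z 0 < (1 / 2 : ℝ) ^ k) : j = k := by
  obtain ⟨h3, h4⟩ := P.fst_mem_of_mem_D hz
  have hj : 0 < (1 / 2 : ℝ) ^ j := by positivity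
  by_contra hne
  rcases lt_or_gt_of_ne hne with h | h
  · have : (1 / 2 : ℝ) ^ k ≤ (1 / 2) ^ (j + 1) :=
      pow_le_pow_of_le_one (by norm_num) (by norm_num) h
    rw [pow_succ] at this
    linarith
  · have : (1 / 2 : ℝ) ^ j ≤ (1 / 2) ^ (k + 1) :=
      pow_le_pow_of_le_one (by norm_num) (by norm_num) h
    linarith

theorem D_disjoint (j k : ℕ) (z : EuclideanSpace ℝ (Fin 2)) (hj : z ∈ P.D j) (hk : z ∈ P.D k) :
    j = k := by
  obtain ⟨h3, h4⟩ := P.fst_mem_of_mem_D hk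
  have hk : 0 < (1 / 2 : ℝ) ^ k := by positivity
  refine P.eq_of_mem_D hj ?_ (by linarith)
  rw [pow_succ]
  linarith

/-- The homeomorphism performing all perturbations of index at least `n`. -/
noncomputable def map (n : ℕ) : EuclideanSpace ℝ (Fin 2) → EuclideanSpace ℝ (Fin 2) :=
  glue P.D n fun k => P.h k

/-- The inverse of `PerturbationSequence.map`. -/
noncomputable def invMap (n : ℕ) : EuclideanSpace ℝ (Fin 2) → EuclideanSpace ℝ (Fin 2) :=
  glue P.D n fun k => (P.h k).symm

theorem tendsto_hoelderConst {α : ℝ} (h1 : α < 1) :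
    Tendsto (fun k => 2 * P.A k * P.r k ^ (1 - α)) atTop (nhds 0) := by
  have hα : 0 < 1 - α := by linarith
  have hg : Tendsto (fun k : ℕ => 2 * ((1 / 2 : ℝ) ^ (1 - α)) ^ k) atTop (nhds 0) := by
    rw [← mul_zero (2 : ℝ)]
    refine (tendsto_pow_atTop_nhds_zero_of_lt_one (by positivity) ?_).const_mul (2 : ℝ)
    exact Real.rpow_lt_one (by norm_num) (by norm_num) hα
  obtain ⟨N, hN⟩ := exists_nat_ge (1 / (1 - α))
  refine tendsto_of_tendsto_of_tendsto_of_le_of_le' tendsto_const_nhds hg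
    (Eventually.of_forall fun k => ?_) ?_
  · have := P.one_le_A k
    have := P.r_pos k
    positivity
  · filter_upwards [eventually_ge_atTop N] with k hk
    have hA := P.one_le_A k
    have hA0 : 0 < P.A k := by linarith
    have hr := P.r_pos k
    have h2 : 1 ≤ (k + 1 : ℝ) * (1 - α) := by
      have : (N : ℝ) ≤ k := by exact_mod_cast hk
      rw [div_le_iff₀ hα] at hN
      nlinarith
    have h3 : P.A k ≤ (P.A k ^ (k + 1)) ^ (1 - α) := by
      rw [← Real.rpow_natCast, ← Real.rpow_mul hA0.le]
      push_cast
      exact Real.self_le_rpow_of_one_le hA h2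
    have h4 : P.A k ^ (k + 1) * P.r k ≤ (1 / 2) ^ k := by
      have : 0 < (1 / 2 : ℝ) ^ k := by positivity
      linarith [P.A_pow_mul_r_le k]
    calc 2 * P.A k * P.r k ^ (1 - α)
        ≤ 2 * (P.A k ^ (k + 1)) ^ (1 - α) * P.r k ^ (1 - α) := by gcongr
      _ = 2 * (P.A k ^ (k + 1) * P.r k) ^ (1 - α) := by
          rw [Real.mul_rpow (by positivity) hr.le]; ring
      _ ≤ 2 * ((1 / 2) ^ k) ^ (1 - α) := by gcongr
      _ = _ := by
          rw [← Real.rpow_natCast, ← Real.rpow_natCast, ← Real.rpow_mul (by norm_num),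
            ← Real.rpow_mul (by norm_num), mul_comm (k : ℝ)]

theorem norm_glue_sub_sub_le_rpow {e : ℕ → EuclideanSpace ℝ (Fin 2) ≃ EuclideanSpace ℝ (Fin 2)}
    (he : ∀ k, IsLocalPerturbation (e k) (dyadicCenter k) (P.A k) (P.r k)) {α C : ℝ} (h0 : 0 ≤ α)
    (h1 : α < 1) {n : ℕ} (hC : ∀ k, n ≤ k → 2 * P.A k * P.r k ^ (1 - α) ≤ C)
    (z w : EuclideanSpace ℝ (Fin 2)) :
    ‖(glue P.D n (fun k => e k) z - z) - (glue P.D n (fun k => e k) w - w)‖ ≤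
      2 * C * dist z w ^ α := by
  rw [mul_assoc]
  refine norm_glue_sub_sub_le P.D_disjoint (fun k => (he k).eq_self) fun k hk => ?_
  have hA := P.one_le_A k
  refine ((he k).norm_sub_sub_le_rpow (by linarith) (P.r_pos k) h0 h1 z w).trans ?_
  gcongr
  exact hC k hk

theorem exists_hoelder_glue {e : ℕ → EuclideanSpace ℝ (Fin 2) ≃ EuclideanSpace ℝ (Fin 2)}
    (he : ∀ k, IsLocalPerturbation (e k) (dyadicCenter k) (P.A k) (P.r k)) {α : ℝ} (h0 : 0 < α)
    (h1 : α < 1) (n : ℕ) : ∃ K : ℝ, 0 < K ∧ ∀ z ∈ unitSq, ∀ w ∈ unitSq,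
      dist (glue P.D n (fun k => e k) z) (glue P.D n (fun k => e k) w) ≤ K * dist z w ^ α := by
  obtain ⟨C, hC⟩ := (P.tendsto_hoelderConst h1).bddAbove_range
  replace hC : ∀ k, 2 * P.A k * P.r k ^ (1 - α) ≤ C := fun k => hC (mem_range_self k)
  refine ⟨2 + 2 * |C|, by positivity, fun z hz w hw => ?_⟩
  have h2 := P.norm_glue_sub_sub_le_rpow he h0.le h1 (n := n) (fun k _ => hC k) z w
  have hd : dist z w ≤ 2 * dist z w ^ α := by
    have hd2 : dist z w ≤ 2 := by
      rw [EuclideanSpace.dist_eq]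
      refine Real.sqrt_le_iff.2 ⟨by norm_num, ?_⟩
      rw [Fin.sum_univ_two, Real.dist_eq, Real.dist_eq, sq_abs, sq_abs]
      nlinarith [(hz 0).1, (hz 0).2, (hz 1).1, (hz 1).2, (hw 0).1, (hw 0).2, (hw 1).1, (hw 1).2]
    have h3 : dist z w ^ (1 - α) ≤ 2 := by
      rcases le_total (dist z w) 1 with h | h
      · exact (Real.rpow_le_one dist_nonneg h (by linarith)).trans (by norm_num)
      · exact (Real.rpow_le_self_of_one_le h (by linarith)).trans hd2
    calc dist z w = dist z w ^ (1 - α) * dist z w ^ α := by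
          rw [← Real.rpow_add' dist_nonneg (by norm_num)]; norm_num
      _ ≤ 2 * dist z w ^ α := by gcongr
  rw [dist_eq_norm (glue _ _ _ _)]
  set G := glue P.D n (fun k => e k)
  have e1 : G z - G w = (z - w) + ((G z - z) - (G w - w)) := by abel
  rw [e1]
  refine (norm_add_le _ _).trans ?_
  rw [← dist_eq_norm z w]
  have h5 : 0 ≤ dist z w ^ α := by positivity
  nlinarith [le_abs_self C]

theorem exists_nhds_map_eq {k : ℕ} {z : EuclideanSpace ℝ (Fin 2)}
    (h1 : (1 / 2 : ℝ) ^ (k + 1) < z 0) (h2 : z 0 < (1 / 2 : ℝ) ^ k) (n : ℕ) :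
    (n ≤ k → P.map n =ᶠ[nhds z] P.h k) ∧ (¬ (n ≤ k ∧ z ∈ P.D k) → P.map n =ᶠ[nhds z] id) := by
  have hc : Continuous fun w : EuclideanSpace ℝ (Fin 2) => w 0 := by fun_prop
  have ev : ∀ᶠ w : EuclideanSpace ℝ (Fin 2) in nhds z,
      (1 / 2 : ℝ) ^ (k + 1) < w 0 ∧ w 0 < (1 / 2 : ℝ) ^ k :=
    (hc.continuousAt.eventually (lt_mem_nhds h1)).and
      (hc.continuousAt.eventually (gt_mem_nhds h2))
  constructor
  · intro hk
    filter_upwards [ev] with w hw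
    by_cases hwD : w ∈ P.D k
    · exact glue_of_mem P.D_disjoint hk hwD
    · rw [(P.pert k).eq_self w hwD]
      refine glue_of_forall_notMem fun j _ hj => hwD ?_
      rwa [← P.eq_of_mem_D hj hw.1 hw.2]
  · intro h
    by_cases hk : n ≤ k
    · have hzD : z ∉ P.D k := fun hz => h ⟨hk, hz⟩
      filter_upwards [ev, Metric.isClosed_closedBall.isOpen_compl.mem_nhds hzD] with w hw hwD
      refine glue_of_forall_notMem fun j _ hj => hwD ?_
      change w ∈ P.D k
      rwa [← P.eq_of_mem_D hj hw.1 hw.2]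
    · filter_upwards [ev] with w hw
      refine glue_of_forall_notMem fun j hj hwj => hk ?_
      rwa [← P.eq_of_mem_D hwj hw.1 hw.2]

theorem mapsTo_h (k : ℕ) : MapsTo (P.h k) (P.D k) (P.D k) := (P.pert k).mapsTo

theorem mapsTo_h_symm (k : ℕ) : MapsTo (P.h k).symm (P.D k) (P.D k) := (P.pert_symm k).mapsTo

theorem mapsTo_map (n : ℕ) : MapsTo (P.map n) unitSq unitSq :=
  glue_mapsTo P.D_disjoint P.mapsTo_h P.D_subset_unitSq

theorem mapsTo_invMap (n : ℕ) : MapsTo (P.invMap n) unitSq unitSq :=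
  glue_mapsTo P.D_disjoint P.mapsTo_h_symm P.D_subset_unitSq

theorem invOn_map (n : ℕ) : InvOn (P.invMap n) (P.map n) unitSq unitSq :=
  ⟨fun z _ => glue_leftInverse P.D_disjoint P.mapsTo_h (fun k => (P.h k).symm_apply_apply) z,
    fun z _ => glue_leftInverse P.D_disjoint P.mapsTo_h_symm (fun k => (P.h k).apply_symm_apply) z⟩

theorem log_le_coverEntropy_map {n k : ℕ} (hk : n ≤ k) :
    ENNReal.log (k + 1 : ℕ) ≤ Dynamics.coverEntropy (P.map n) unitSq := by
  obtain ⟨ε, hε, H⟩ := P.sep k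
  have hU : {p : EuclideanSpace ℝ (Fin 2) × EuclideanSpace ℝ (Fin 2) | dist p.1 p.2 < ε / 2} ∈
      uniformity (EuclideanSpace ℝ (Fin 2)) := Metric.dist_mem_uniformity (half_pos hε)
  refine le_trans ?_ (Dynamics.netEntropyEntourage_le_coverEntropy _ _ hU)
  rw [Dynamics.netEntropyEntourage, ← ExpGrowth.expGrowthSup_pow]
  refine ExpGrowth.expGrowthSup_monotone fun N => ?_
  obtain ⟨p, hpD, hp⟩ := H N
  have hit : ∀ (i : ℕ) w, (P.map n)^[i] (p w) = (P.h k)^[i] (p w) := fun i w =>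
    glue_iterate P.D_disjoint P.mapsTo_h hk (hpD w) i
  have hinj : Function.Injective p := fun w w' hww => by
    by_contra hne
    obtain ⟨i, -, h⟩ := hp w w' hne
    rw [hww, dist_self] at h
    linarith
  have hnet : Dynamics.IsDynNetIn (P.map n) unitSq
      {p | dist p.1 p.2 < ε / 2} N (Finset.univ.map ⟨p, hinj⟩ : Finset _) := by
    constructor
    · rintro z hz
      simp only [Finset.coe_map, Finset.coe_univ, image_univ, mem_range] at hz
      obtain ⟨w, rfl⟩ := hz
      exact P.D_subset_unitSq k (hpD w)
    · rintro z hz z' hz' hne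
      simp only [Finset.coe_map, Finset.coe_univ, image_univ, mem_range] at hz hz'
      obtain ⟨w, rfl⟩ := hz
      obtain ⟨w', rfl⟩ := hz'
      refine Set.disjoint_left.2 fun y hy hy' => ?_
      obtain ⟨i, hi, h⟩ := hp w w' (fun h => hne (by rw [h]))
      have h1 := Dynamics.mem_ball_dynEntourage.1 hy i hi
      have h2 := Dynamics.mem_ball_dynEntourage.1 hy' i hi
      have h3 : dist ((P.map n)^[i] (p w)) ((P.map n)^[i] y) < ε / 2 := h1
      have h4 : dist ((P.map n)^[i] (p w')) ((P.map n)^[i] y) < ε / 2 := h2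
      rw [hit] at h3 h4
      have := dist_triangle_right ((P.h k)^[i] (p w)) ((P.h k)^[i] (p w')) ((P.map n)^[i] y)
      linarith
  have hcard := hnet.card_le_netMaxcard
  simp only [Finset.card_map, Finset.card_univ, Fintype.card_fun, Fintype.card_fin] at hcard
  have := ENat.toENNReal_mono hcard
  simpa using this

theorem coverEntropy_map (n : ℕ) : Dynamics.coverEntropy (P.map n) unitSq = ⊤ := by
  by_contra h
  obtain ⟨x, hx⟩ := ENNReal.log_surjective (Dynamics.coverEntropy (P.map n) unitSq)
  have hxt : x ≠ ⊤ := by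
    rintro rfl
    exact h (by rw [← hx, ENNReal.log_top])
  obtain ⟨N, hN⟩ := ENNReal.exists_nat_gt hxt
  have h1 := P.log_le_coverEntropy_map (le_max_left n N)
  rw [← hx, ENNReal.log_le_log_iff] at h1
  refine absurd (h1.trans_lt hN) (not_lt.2 ?_)
  exact_mod_cast (le_max_right n N).trans (Nat.le_succ _)

theorem exists_forall_map_close {α : ℝ} (h0 : 0 ≤ α) (h1 : α < 1) {ε : ℝ} (hε : 0 < ε) :
    ∃ N : ℕ, ∀ n, N ≤ n → ∀ x y : EuclideanSpace ℝ (Fin 2),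
      ‖(P.map n x - x) - (P.map n y - y)‖ ≤ ε * dist x y ^ α := by
  obtain ⟨N, hN⟩ := eventually_atTop.1
    ((P.tendsto_hoelderConst h1).eventually (ge_mem_nhds (half_pos hε)))
  refine ⟨N, fun n hn x y => ?_⟩
  have := P.norm_glue_sub_sub_le_rpow P.pert h0 h1 (n := n) (fun k hk => hN k (hn.trans hk)) x y
  rwa [mul_div_cancel₀ _ (two_ne_zero)] at this

theorem map_zero_eq (n : ℕ) : P.map n 0 = 0 := by
  refine glue_of_forall_notMem fun k _ hk => ?_
  have := (P.fst_mem_of_mem_D hk).1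
  have h : 0 < (1 / 2 : ℝ) ^ k := by positivity
  simp only [PiLp.zero_apply] at this
  linarith

theorem ae_mem_dyadic_strip : ∀ᵐ z ∂(volume.restrict unitSq), ∃ k : ℕ,
    (1 / 2 : ℝ) ^ (k + 1) < z 0 ∧ z 0 < (1 / 2 : ℝ) ^ k := by
  have hne : ∀ c : ℝ, ∀ᵐ z : EuclideanSpace ℝ (Fin 2), z 0 ≠ c := fun c =>
    (PiLp.volume_preserving_ofLp (Fin 2)).quasiMeasurePreserving.ae
      (Measure.ae_eval_ne (fun _ : Fin 2 => (volume : Measure ℝ)) 0 c)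
  have hcl : MeasurableSet unitSq := by
    have : unitSq = ⋂ i, (fun z : EuclideanSpace ℝ (Fin 2) => z i) ⁻¹' Icc (0 : ℝ) 1 := by
      ext z; simp [unitSq]
    rw [this]
    exact MeasurableSet.iInter fun i => (by fun_prop : Measurable _) measurableSet_Icc
  filter_upwards [ae_restrict_mem hcl, ae_restrict_of_ae (hne 0),
    ae_restrict_of_ae (ae_all_iff.2 fun k : ℕ => hne ((1 / 2) ^ k))] with z hz h0 hk
  obtain ⟨k, h1, h2⟩ := exists_nat_pow_near_of_lt_one (lt_of_le_of_ne (hz 0).1 h0.symm) (hz 0).2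
    (by norm_num : (0 : ℝ) < 1 / 2) (by norm_num)
  exact ⟨k, h1, lt_of_le_of_ne h2 (hk k)⟩

theorem lipschitzWith_h_sub (k : ℕ) :
    LipschitzWith (P.A k).toNNReal fun z => P.h k z - z := by
  refine LipschitzWith.of_dist_le_mul fun z w => ?_
  rw [Real.coe_toNNReal _ (by linarith [P.one_le_A k]), dist_eq_norm, dist_eq_norm]
  exact (P.pert k).norm_sub_sub_le z w

theorem ae_differentiableAt_h (k : ℕ) : ∀ᵐ z, DifferentiableAt ℝ (P.h k) z := by
  filter_upwards [(P.lipschitzWith_h_sub k).ae_differentiableAt] with z hz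
  simpa using hz.add differentiableAt_fun_id

theorem ae_differentiableAt_map (n : ℕ) :
    ∀ᵐ z ∂(volume.restrict unitSq), DifferentiableAt ℝ (P.map n) z := by
  filter_upwards [ae_mem_dyadic_strip,
    ae_restrict_of_ae (ae_all_iff.2 P.ae_differentiableAt_h)] with z ⟨k, h1, h2⟩ hz
  obtain ⟨e1, e2⟩ := P.exists_nhds_map_eq h1 h2 n
  by_cases hk : n ≤ k
  · exact (hz k).congr_of_eventuallyEq (e1 hk)
  · exact differentiableAt_id.congr_of_eventuallyEq (e2 fun h => hk h.1)

theorem derivDistId_h_le {k : ℕ} {z : EuclideanSpace ℝ (Fin 2)}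
    (hz : DifferentiableAt ℝ (P.h k) z) : derivDistId (P.h k) z ≤ 4 * P.A k := by
  have hn : ‖fderiv ℝ (fun z => P.h k z - z) z‖ ≤ P.A k := by
    have := norm_fderiv_le_of_lipschitz ℝ (P.lipschitzWith_h_sub k) (x₀ := z)
    rwa [Real.coe_toNNReal _ (by linarith [P.one_le_A k])] at this
  rw [fderiv_fun_sub hz differentiableAt_fun_id, fderiv_fun_id] at hn
  have key : ∀ i j : Fin 2, |fderiv ℝ (P.h k) z (EuclideanSpace.single j 1) i -
      (if i = j then 1 else 0)| ≤ P.A k := fun i j => by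
    have h1 := ContinuousLinearMap.le_opNorm
      (fderiv ℝ (P.h k) z - ContinuousLinearMap.id ℝ _) (EuclideanSpace.single j 1)
    have h2 := (PiLp.norm_apply_le _ i).trans h1
    rw [EuclideanSpace.single, PiLp.norm_single, norm_one, mul_one] at h2
    refine le_trans (le_of_eq ?_) (h2.trans hn)
    rw [Real.norm_eq_abs, sub_apply, PiLp.sub_apply,
      ContinuousLinearMap.id_apply]
    congr 2
    exact (PiLp.single_apply ..).symm
  unfold derivDistId
  rw [Fin.sum_univ_two, Fin.sum_univ_two, Fin.sum_univ_two]
  linarith [key 0 0, key 0 1, key 1 0, key 1 1]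

theorem derivDistId_id (z : EuclideanSpace ℝ (Fin 2)) : derivDistId id z = 0 := by
  simp [derivDistId]

theorem derivDistId_congr {f g : EuclideanSpace ℝ (Fin 2) → EuclideanSpace ℝ (Fin 2)}
    {z : EuclideanSpace ℝ (Fin 2)} (h : f =ᶠ[nhds z] g) : derivDistId f z = derivDistId g z := by
  simp only [derivDistId, h.fderiv_eq]

theorem derivDistId_nonneg (f : EuclideanSpace ℝ (Fin 2) → EuclideanSpace ℝ (Fin 2))
    (z : EuclideanSpace ℝ (Fin 2)) : 0 ≤ derivDistId f z := by
  unfold derivDistId; positivity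

theorem ae_derivDistId_map_le {q : ℝ} (hq : 0 < q) (n : ℕ) :
    ∀ᵐ z ∂(volume.restrict unitSq), ENNReal.ofReal (derivDistId (P.map n) z ^ q) ≤
      ∑' j, (P.D (j + n)).indicator
        (fun _ => ENNReal.ofReal ((4 * P.A (j + n)) ^ q)) z := by
  filter_upwards [ae_mem_dyadic_strip,
    ae_restrict_of_ae (ae_all_iff.2 P.ae_differentiableAt_h)] with z ⟨k, h1, h2⟩ hz
  obtain ⟨e1, e2⟩ := P.exists_nhds_map_eq h1 h2 n
  by_cases hk : n ≤ k ∧ z ∈ P.D k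
  · refine le_trans ?_ (ENNReal.le_tsum (k - n))
    rw [Nat.sub_add_cancel hk.1, indicator_of_mem hk.2, derivDistId_congr (e1 hk.1)]
    exact ENNReal.ofReal_le_ofReal
      (Real.rpow_le_rpow (derivDistId_nonneg _ _) (P.derivDistId_h_le (hz k)) hq.le)
  · rw [derivDistId_congr (e2 hk), derivDistId_id, Real.zero_rpow hq.ne', ENNReal.ofReal_zero]
    exact zero_le

theorem summable_derivative_bound (q : ℝ) :
    Summable fun k => (4 * P.A k) ^ q * (P.A k * P.r k) ^ 2 := by
  have hg : Summable fun k : ℕ => (4 : ℝ) ^ q * (1 / 2) ^ k :=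
    (summable_geometric_of_lt_one (by norm_num) (by norm_num)).mul_left _
  obtain ⟨N, hN⟩ := exists_nat_ge q
  refine Summable.of_norm_bounded_eventually_nat hg ?_
  filter_upwards [eventually_ge_atTop (N + 1)] with k hk
  have hA := P.one_le_A k
  have hA0 : 0 < P.A k := by linarith
  have hr := P.r_pos k
  rw [Real.norm_of_nonneg (by positivity), Real.mul_rpow (by norm_num) hA0.le, mul_assoc]
  gcongr
  have h1 : P.A k ^ q ≤ P.A k ^ N := by
    rw [← Real.rpow_natCast]
    exact Real.rpow_le_rpow_of_exponent_le hA hN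
  have h2 : (1 / 2 : ℝ) ^ k / 8 ≤ (1 / 2 : ℝ) ^ k := by
    have : 0 < (1 / 2 : ℝ) ^ k := by positivity
    linarith
  calc P.A k ^ q * (P.A k * P.r k) ^ 2 ≤ P.A k ^ N * (P.A k * P.r k) ^ 2 := by gcongr
    _ = P.A k ^ (N + 2) * P.r k * P.r k := by ring
    _ ≤ P.A k ^ (k + 1) * P.r k * 1 := by
        have h3 : P.A k ^ (N + 2) ≤ P.A k ^ (k + 1) := pow_le_pow_right₀ hA (by lia)
        exact mul_le_mul (mul_le_mul_of_nonneg_right h3 hr.le) (P.r_le_one k) hr.le (by positivity)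
    _ ≤ (1 / 2) ^ k := by rw [mul_one]; exact (P.A_pow_mul_r_le k).trans h2

theorem tendsto_lintegral_derivDistId_map {q : ℝ} (hq : 0 < q) :
    Tendsto (fun n => ∫⁻ x in unitSq, ENNReal.ofReal (derivDistId (P.map n) x ^ q))
      atTop (nhds 0) := by
  set V := volume (Metric.ball (0 : EuclideanSpace ℝ (Fin 2)) 1) with hV
  set F : ℕ → ℝ≥0∞ := fun k => ENNReal.ofReal ((4 * P.A k) ^ q * (P.A k * P.r k) ^ 2) * V with hF
  have hVt : V ≠ ⊤ := measure_ball_lt_top.ne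
  have hFs : ∑' k, F k ≠ ⊤ := by
    rw [ENNReal.tsum_mul_right]
    exact ENNReal.mul_ne_top (P.summable_derivative_bound q).tsum_ofReal_ne_top hVt
  refine tendsto_of_tendsto_of_tendsto_of_le_of_le tendsto_const_nhds
    (ENNReal.tendsto_sum_nat_add F hFs) (fun _ => zero_le) fun n => ?_
  refine (lintegral_mono_ae (P.ae_derivDistId_map_le hq n)).trans ?_
  have hD : ∀ k, MeasurableSet (P.D k) := fun k => measurableSet_closedBall
  rw [lintegral_tsum fun j => (measurable_const.indicator (hD _)).aemeasurable]
  refine ENNReal.tsum_le_tsum fun j => ?_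
  rw [lintegral_indicator_const (hD _)]
  have hA := P.one_le_A (j + n)
  have hr := P.r_pos (j + n)
  refine (mul_le_mul_right (Measure.restrict_apply_le _ _) _).trans (le_of_eq ?_)
  rw [D, Measure.addHaar_closedBall _ _ (by positivity), finrank_euclideanSpace_fin,
    ← mul_assoc, ← ENNReal.ofReal_mul (by positivity)]

end PerturbationSequence

theorem continuousOn_of_hoelder {X Y : Type*} [PseudoMetricSpace X] [PseudoMetricSpace Y]
    {f : X → Y} {s : Set X} {K α : ℝ} (hα : 0 < α)
    (h : ∀ z ∈ s, ∀ w ∈ s, dist (f z) (f w) ≤ K * dist z w ^ α) : ContinuousOn f s := by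
  intro w hw
  rw [ContinuousWithinAt, tendsto_iff_dist_tendsto_zero]
  have h1 : Tendsto (fun z => K * dist z w ^ α) (nhdsWithin w s) (nhds 0) := by
    have : ContinuousAt (fun z => K * dist z w ^ α) w :=
      continuousAt_const.mul
        ((continuous_id.dist continuous_const).continuousAt.rpow_const (Or.inr hα.le))
    have h2 := this.tendsto.mono_left (nhdsWithin_le_nhds (s := s))
    simpa [Real.zero_rpow hα.ne'] using h2
  exact squeeze_zero' (Eventually.of_forall fun _ => dist_nonneg)
    (eventually_mem_nhdsWithin.mono fun z hz => h z hz w hw) h1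

/-- **Infinite-entropy homeomorphisms of the square converging to the identity**: there is a
sequence `(f_n)` of homeomorphisms of `Q = [0,1]²` onto itself such that (1) each `f_n` has
infinite topological entropy; (2) each `f_n` and `f_n⁻¹` is `α`-Hölder for every
`α ∈ (0,1)`; (3) `f_n → id` in the `C^α`-norm for every `α ∈ [0,1)`; and (4) each `f_n` is
differentiable a.e. on `Q` and `∫_Q |Df_n - Id|^q dμ → 0` for every `q ∈ [1,∞)`. -/
theorem infinite_entropy_sequence_to_identity :
    ∃ f fi : ℕ → EuclideanSpace ℝ (Fin 2) → EuclideanSpace ℝ (Fin 2),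
      (∀ n, Set.BijOn (f n) unitSq unitSq ∧ ContinuousOn (f n) unitSq ∧
        Set.InvOn (fi n) (f n) unitSq unitSq ∧ ContinuousOn (fi n) unitSq) ∧
      -- (1) infinite topological entropy
      (∀ n, Dynamics.coverEntropy (f n) unitSq = ⊤) ∧
      -- (2) `f_n` and `f_n⁻¹` are `α`-Hölder for every `α ∈ (0,1)`
      (∀ n, ∀ α : ℝ, 0 < α → α < 1 → ∃ K : ℝ, 0 < K ∧
        ∀ z ∈ unitSq, ∀ w ∈ unitSq,
          dist (f n z) (f n w) ≤ K * dist z w ^ α ∧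
          dist (fi n z) (fi n w) ≤ K * dist z w ^ α) ∧
      -- (3) convergence to the identity in the `C^α`-norm for every `α ∈ [0,1)`
      (∀ α : ℝ, 0 ≤ α → α < 1 → ∀ ε : ℝ, 0 < ε → ∃ N : ℕ, ∀ n, N ≤ n →
        (∀ x ∈ unitSq, dist (f n x) x ≤ ε) ∧
        (∀ x ∈ unitSq, ∀ y ∈ unitSq,
          ‖(f n x - x) - (f n y - y)‖ ≤ ε * dist x y ^ α)) ∧
      -- (4) a.e. differentiability and `W^{1,q}`-convergence of the derivatives
      (∀ n, ∀ᵐ x ∂(volume.restrict unitSq), DifferentiableAt ℝ (f n) x) ∧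
      (∀ q : ℝ, 1 ≤ q →
        Tendsto (fun n => ∫⁻ x in unitSq, ENNReal.ofReal (derivDistId (f n) x ^ q))
          atTop (nhds 0)) := by
  obtain ⟨P⟩ := nonempty_perturbationSequence dyadicCenter
  have hcont : ∀ (e : ℕ → EuclideanSpace ℝ (Fin 2) ≃ EuclideanSpace ℝ (Fin 2)),
      (∀ k, IsLocalPerturbation (e k) (dyadicCenter k) (P.A k) (P.r k)) → ∀ n,
      ContinuousOn (glue P.D n fun k => e k) unitSq := fun e he n => by
    obtain ⟨K, -, hK⟩ := P.exists_hoelder_glue he (α := 1 / 2) (by norm_num) (by norm_num) n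
    exact continuousOn_of_hoelder (by norm_num) hK
  refine ⟨P.map, P.invMap, fun n => ⟨?_, hcont _ P.pert n, P.invOn_map n, hcont _ P.pert_symm n⟩,
    P.coverEntropy_map, fun n α h0 h1 => ?_, fun α h0 h1 ε hε => ?_, P.ae_differentiableAt_map,
    fun q hq => P.tendsto_lintegral_derivDistId_map (by linarith)⟩
  · exact (P.invOn_map n).bijOn (P.mapsTo_map n) (P.mapsTo_invMap n)
  · obtain ⟨K, hK, H⟩ := P.exists_hoelder_glue P.pert h0 h1 n
    obtain ⟨K', hK', H'⟩ := P.exists_hoelder_glue P.pert_symm h0 h1 n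
    refine ⟨max K K', lt_max_of_lt_left hK, fun z hz w hw =>
      ⟨(H z hz w hw).trans ?_, (H' z hz w hw).trans ?_⟩⟩
    · gcongr; exact le_max_left _ _
    · gcongr; exact le_max_right _ _
  · obtain ⟨N, hN⟩ := P.exists_forall_map_close h0 h1 hε
    obtain ⟨N', hN'⟩ := P.exists_forall_map_close le_rfl zero_lt_one hε
    refine ⟨max N N', fun n hn => ⟨fun x _ => ?_, fun x _ y _ =>
      hN n ((le_max_left _ _).trans hn) x y⟩⟩
    have := hN' n ((le_max_right _ _).trans hn) x 0
    rwa [P.map_zero_eq, sub_zero, sub_zero, Real.rpow_zero, mul_one, ← dist_eq_norm] at this
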